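/- Let G be a finite abstract simplicial complex and define the counting matrix L, indexed by the simplices of G, by L(x,y) = number of simplices z ∈ G with z ⊆ x ∩ y. Then L is similar to its inverse: L and L⁻¹ have the same characteristic polynomial, i.e. there is an invertible real matrix P with P · L · P⁻¹ = L⁻¹ (equivalently, the spectrum of L is invariant under λ ↦ 1/λ). -/

import Mathlib

open Finset in
theorem Finset.sum_Icc_neg_one_pow_card {V R : Type*} [DecidableEq V] [CommRing R]
    {y x : Finset V} (h : y ⊆ x) :
    ∑ z ∈ Icc y x, (-1 : R) ^ #z = if y = x then (-1) ^ #y else 0 := by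
  have key : ∑ t ∈ (x \ y).powerset, (-1 : R) ^ #t = if x \ y = ∅ then 1 else 0 := by
    exact_mod_cast congrArg (Int.cast : ℤ → R) (sum_powerset_neg_one_pow_card (x := x \ y))
  have hdisj : ∀ t ∈ (x \ y).powerset, Disjoint y t := fun t ht =>
    disjoint_of_subset_right (mem_powerset.1 ht) disjoint_sdiff
  have hinj : Set.InjOn (y ∪ ·) ((x \ y).powerset : Set (Finset V)) := by
    intro s hs t ht hst
    rw [← union_sdiff_cancel_left (hdisj s hs), ← union_sdiff_cancel_left (hdisj t ht)]
    exact congrArg (· \ y) hst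
  rw [Icc_eq_image_powerset h, sum_image hinj,
    sum_congr rfl fun t ht => by rw [card_union_of_disjoint (hdisj t ht), pow_add],
    ← mul_sum, key]
  have hiff : x \ y = ∅ ↔ y = x := by
    rw [sdiff_eq_empty_iff_subset]
    exact ⟨h.antisymm, fun e => e.ge⟩
  simp [hiff]

/-- The matrix `P x z = (-1) ^ #z` if `z ⊆ x` and `0` otherwise, on a family of finite sets. -/
def signedInclusionMatrix {V : Type*} [DecidableEq V] (G : Finset (Finset V))
    (R : Type*) [CommRing R] : Matrix {x // x ∈ G} {x // x ∈ G} R :=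
  .of fun x z => if (z : Finset V) ⊆ x then (-1) ^ (z : Finset V).card else 0

/-- On a family containing the intervals between its members, the signed inclusion matrix is
an involution. -/
theorem signedInclusionMatrix_mul_self {V R : Type*} [DecidableEq V] [CommRing R]
    {G : Finset (Finset V)} (hG : ∀ y ∈ G, ∀ x ∈ G, Finset.Icc y x ⊆ G) :
    signedInclusionMatrix G R * signedInclusionMatrix G R = 1 := by
  ext ⟨x, hx⟩ ⟨y, hy⟩
  have hsum : (signedInclusionMatrix G R * signedInclusionMatrix G R) ⟨x, hx⟩ ⟨y, hy⟩ =
      (∑ z ∈ Finset.Icc y x, (-1 : R) ^ z.card) * (-1) ^ y.card := by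
    simp only [signedInclusionMatrix, Matrix.mul_apply, Matrix.of_apply]
    rw [Finset.sum_coe_sort G fun z => (if z ⊆ x then (-1 : R) ^ z.card else 0) *
      (if y ⊆ z then (-1) ^ y.card else 0), Finset.sum_mul,
      ← Finset.sum_subset (hG y hy x hx)]
    · refine Finset.sum_congr rfl fun z hz => ?_
      obtain ⟨hyz, hzx⟩ := Finset.mem_Icc.1 hz
      rw [if_pos hzx, if_pos hyz]
    · intro z _ hz
      by_cases hzx : z ⊆ x
      · rw [if_neg fun hyz => hz (Finset.mem_Icc.2 ⟨hyz, hzx⟩), mul_zero]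
      · rw [if_neg hzx, zero_mul]
  rw [hsum]
  by_cases h : y ⊆ x
  · rw [Finset.sum_Icc_neg_one_pow_card h]
    by_cases e : y = x
    · subst e
      simp [← mul_pow]
    · rw [if_neg e, zero_mul, Matrix.one_apply_ne fun e' => e (congrArg Subtype.val e').symm]
  · rw [Finset.Icc_eq_empty h, Finset.sum_empty, zero_mul,
      Matrix.one_apply_ne fun e' => h (congrArg Subtype.val e').ge]

theorem signedInclusionMatrix_mul_transpose_apply {V R : Type*} [DecidableEq V] [CommRing R]
    (G : Finset (Finset V)) (x y : {x // x ∈ G}) :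
    (signedInclusionMatrix G R * (signedInclusionMatrix G R).transpose) x y =
      ((G.filter (fun z => z ⊆ (x : Finset V) ∩ (y : Finset V))).card : R) := by
  simp only [signedInclusionMatrix, Matrix.mul_apply, Matrix.transpose_apply, Matrix.of_apply]
  rw [Finset.sum_coe_sort G fun z => (if z ⊆ (x : Finset V) then (-1 : R) ^ z.card else 0) *
    (if z ⊆ (y : Finset V) then (-1) ^ z.card else 0), Finset.natCast_card_filter]
  refine Finset.sum_congr rfl fun z _ => ?_
  by_cases hx : z ⊆ (x : Finset V) <;> by_cases hy : z ⊆ (y : Finset V) <;>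
    simp [hx, hy, Finset.subset_inter_iff, ← mul_pow]

/-- **The counting matrix is of symplectic nature.**  Let `G` be a finite
abstract simplicial complex and `L` its counting matrix
`L x y = #{z ∈ G | z ⊆ x ∩ y}`.  Then `L` is similar to its inverse: `L` and
`L⁻¹` have the same characteristic polynomial, i.e. there is an invertible
real matrix `P` with `P * L * P⁻¹ = L⁻¹` (so the spectrum of `L` is invariant
under `λ ↦ 1/λ`). -/
theorem counting_matrix_similar_to_inverse
    {V : Type*} [Fintype V] [DecidableEq V]
    (G : Finset (Finset V))
    (hne : ∀ x ∈ G, x.Nonempty)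
    (hclosed : ∀ x ∈ G, ∀ y : Finset V, y ⊆ x → y.Nonempty → y ∈ G)
    (L : Matrix {x // x ∈ G} {x // x ∈ G} ℝ)
    (hL : ∀ x y : {x // x ∈ G},
      L x y = ((G.filter (fun z => z ⊆ (x : Finset V) ∩ (y : Finset V))).card : ℝ)) :
    L.charpoly = (L⁻¹).charpoly ∧
      ∃ P : Matrix {x // x ∈ G} {x // x ∈ G} ℝ,
        IsUnit P.det ∧ P * L * P⁻¹ = L⁻¹ := by
  set P := signedInclusionMatrix G ℝ
  have hPP : P * P = 1 := signedInclusionMatrix_mul_self fun y hy x hx z hz =>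
    hclosed x hx z (Finset.mem_Icc.1 hz).2 ((hne y hy).mono (Finset.mem_Icc.1 hz).1)
  have hLP : L = P * P.transpose := by
    ext x y
    rw [hL, signedInclusionMatrix_mul_transpose_apply]
  have hPinv : P⁻¹ = P := Matrix.inv_eq_right_inv hPP
  have hLinv : L⁻¹ = P.transpose * P := by
    rw [hLP, Matrix.mul_inv_rev, ← Matrix.transpose_nonsing_inv, hPinv]
  refine ⟨?_, P, Matrix.isUnit_det_of_right_inverse hPP, ?_⟩
  · rw [hLinv, hLP, Matrix.charpoly_mul_comm]
  · rw [hPinv, hLinv, hLP, ← mul_assoc, hPP, one_mul]
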